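/- arXiv:2503.04430 — 3 statements merged into one kernel-verified Lean document; each statement's English description precedes it below -/
import Mathlib

section
/- Let T be a hyperaffine algebraic theory, f ∈ T(n), and g₁,…,gₙ ∈ T(m). Then for every 1 ≤ i ≤ m the i-th coefficient of the composite satisfies (f ∘ (g₁,…,gₙ))[i] = (f[1] ∧ g₁[i]) ∨ ((f[2] ∧ g₂[i]) ∨ (⋯ ∨ (f[n] ∧ gₙ[i]))), where ∧ and ∨ are the Boolean operations on T(2). (This is the key identity showing that the coefficient map T(n) → T(2)ⁿ is a morphism of theories.) -/
/-!
An algebraic theory (abstract clone): a family of sets `T n`,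
projections `π n i` and composition `comp`, subject to the unit
and associativity laws.
-/
universe u

structure Clone where
  T : ℕ → Type u
  π : (n : ℕ) → Fin n → T n
  comp : {n m : ℕ} → T n → (Fin n → T m) → T m
  comp_proj : ∀ {n m : ℕ} (i : Fin n) (g : Fin n → T m), comp (π n i) g = g i
  proj_comp : ∀ {n : ℕ} (f : T n), comp f (π n) = f
  assoc : ∀ {n m k : ℕ} (f : T n) (g : Fin n → T m) (h : Fin m → T k),
      comp (comp f g) h = comp f (fun i => comp (g i) h)

namespace Clone

variable (C : Clone)

/-- `f` is idempotent: `f ∘ (g,…,g) = g`. -/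
def Idem {n : ℕ} (f : C.T n) : Prop :=
  ∀ (m : ℕ) (g : C.T m), C.comp f (fun _ => g) = g

/-- `f` splits: `f(f(x¹₁,…,x¹ₙ),…,f(xⁿ₁,…,xⁿₙ)) = f(x¹₁,x²₂,…,xⁿₙ)` as an identity. -/
def Splits {n : ℕ} (f : C.T n) : Prop :=
  ∀ (m : ℕ) (x : Fin n → Fin n → C.T m),
    C.comp f (fun i => C.comp f (x i)) = C.comp f (fun i => x i i)

/-- `f` and `g` commute. -/
def Commutes {n m : ℕ} (f : C.T n) (g : C.T m) : Prop :=
  ∀ (k : ℕ) (x : Fin n → Fin m → C.T k),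
    C.comp f (fun i => C.comp g (x i)) = C.comp g (fun j => C.comp f (fun i => x i j))

/-- A theory is hyperaffine if every operation is idempotent, every pair of
operations commutes, and every operation splits. -/
def Hyperaffine : Prop :=
  (∀ (n : ℕ) (f : C.T n), C.Idem f) ∧
  (∀ (n m : ℕ) (f : C.T n) (g : C.T m), C.Commutes f g) ∧
  (∀ (n : ℕ) (f : C.T n), C.Splits f)

/-- The `i`-th coefficient `f[i] := f ∘ (π²₂,…,π²₁,…,π²₂)` with `π²₁` in position `i`. -/
def coeff {n : ℕ} (f : C.T n) (i : Fin n) : C.T 2 :=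
  C.comp f (fun j => if j = i then C.π 2 0 else C.π 2 1)

/-- `a ∧ b := a ∘ (b, π²₂)` on `T 2`. -/
def band (a b : C.T 2) : C.T 2 := C.comp a ![b, C.π 2 1]

/-- `a ∨ b := a ∘ (π²₁, b)` on `T 2`. -/
def bor (a b : C.T 2) : C.T 2 := C.comp a ![C.π 2 0, b]

/-- `¬a := a ∘ (π²₂, π²₁)` on `T 2`. -/
def bnot (a : C.T 2) : C.T 2 := C.comp a ![C.π 2 1, C.π 2 0]

/-- `p ∈ T 3` is a Mal'cev operation: `p(x,y,y) = x` and `p(x,x,y) = y`. -/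
def Malcev (p : C.T 3) : Prop :=
  ∀ (m : ℕ) (x y : C.T m), C.comp p ![x, y, y] = x ∧ C.comp p ![x, x, y] = y

/-- `a + b := p ∘ (a, π²₂, b)` on `T 2`. -/
def padd (p : C.T 3) (a b : C.T 2) : C.T 2 := C.comp p ![a, C.π 2 1, b]

/-- `-a := p ∘ (π²₂, a, π²₂)` on `T 2`. -/
def pneg (p : C.T 3) (a : C.T 2) : C.T 2 := C.comp p ![C.π 2 1, a, C.π 2 1]

end Clone

/-- Right-nested fold: `rfold op a [b, c] = op a (op b c)`. -/
def rfold {α : Type*} (op : α → α → α) : α → List α → α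
  | a, [] => a
  | a, b :: l => op a (rfold op b l)

/-- Left-nested fold: `lfold op a [b, c] = op (op a b) c`. -/
def lfold {α : Type*} (op : α → α → α) (a : α) (l : List α) : α := l.foldl op a

namespace Clone

variable {C : Clone}

theorem coeff_comp {n m : ℕ} (f : C.T n) (g : Fin n → C.T m) (i : Fin m) :
    C.coeff (C.comp f g) i = C.comp f fun j => C.coeff (g j) i :=
  C.assoc f g _

theorem band_coeff {n : ℕ} (f : C.T n) (k : Fin n) (b : C.T 2) :
    C.band (C.coeff f k) b = C.comp f fun j => if j = k then b else C.π 2 1 := by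
  unfold band coeff
  rw [C.assoc]
  congr 1
  funext j
  split_ifs <;> simp [C.comp_proj]

theorem bor_zero (b : C.T 2) : C.bor b (C.π 2 1) = b := by
  have h : ![C.π 2 0, C.π 2 1] = C.π 2 := by
    funext j
    fin_cases j <;> rfl
  rw [bor, h, C.proj_comp]

theorem Hyperaffine.bor_self (hC : C.Hyperaffine) (b : C.T 2) : C.bor b b = b := by
  have h := hC.2.2 2 b 2 ![fun _ => C.π 2 0, C.π 2]
  have h₁ : (fun i => C.comp b (![fun _ => C.π 2 0, C.π 2] i)) = ![C.π 2 0, b] := by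
    funext j
    fin_cases j
    · exact hC.1 2 b 2 _
    · exact C.proj_comp b
  have h₂ : (fun i => ![fun _ => C.π 2 0, C.π 2] i i) = C.π 2 := by
    funext j
    fin_cases j <;> rfl
  rwa [h₁, h₂, C.proj_comp] at h

theorem Hyperaffine.bor_comp (hC : C.Hyperaffine) {n : ℕ} (f : C.T n) (b : C.T 2)
    (x : Fin n → C.T 2) :
    C.bor b (C.comp f x) = C.comp f fun j => C.bor b (x j) := by
  have h := hC.2.1 2 n b f 2 ![fun _ => C.π 2 0, x]
  have h₁ : (fun i => C.comp f (![fun _ => C.π 2 0, x] i)) = ![C.π 2 0, C.comp f x] := by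
    funext j
    fin_cases j
    · exact hC.1 n f 2 _
    · rfl
  have h₂ : (fun j => C.comp b fun i => ![fun _ => C.π 2 0, x] i j) =
      fun j => C.bor b (x j) := by
    funext j
    unfold bor
    congr 1
    funext i
    fin_cases i <;> rfl
  rwa [h₁, h₂] at h

/-- Joining one term `f[k] ∧ b` onto `f ∘ x` joins `b` onto the `k`-th argument only. -/
theorem Hyperaffine.bor_band_coeff_comp (hC : C.Hyperaffine) {n : ℕ} (f : C.T n) (k : Fin n)
    (b : C.T 2) (x : Fin n → C.T 2) :
    C.bor (C.band (C.coeff f k) b) (C.comp f x) =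
      C.comp f fun j => if j = k then C.bor b (x j) else x j := by
  rw [band_coeff, bor, C.assoc,
    ← hC.2.2 n f 2 fun i j => if i = k then C.bor b (x j) else x j]
  congr 1
  funext i
  split_ifs
  · exact hC.bor_comp f b x
  · exact C.comp_proj 1 _

theorem Hyperaffine.rfold_bor_band_coeff (hC : C.Hyperaffine) {n : ℕ} (f : C.T n)
    (b : Fin n → C.T 2) (k : Fin n) (l : List (Fin n)) :
    rfold C.bor (C.band (C.coeff f k) (b k)) (l.map fun j => C.band (C.coeff f j) (b j)) =
      C.comp f fun j => if j ∈ k :: l then b j else C.π 2 1 := by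
  induction l generalizing k with
  | nil =>
    simp only [List.map_nil, rfold, band_coeff, List.mem_singleton]
    congr 1
    funext j
    split_ifs with h <;> simp [h]
  | cons a l ih =>
    rw [List.map_cons, rfold, ih, hC.bor_band_coeff_comp]
    congr 1
    funext j
    by_cases h : j = k
    · subst h
      rw [if_pos rfl, if_pos List.mem_cons_self]
      split_ifs
      · exact hC.bor_self _
      · exact bor_zero _
    · simp [h]

end Clone

/-- In a hyperaffine theory, the `i`-th coefficient of a composite satisfies
`(f ∘ (g₁,…,gₙ))[i] = (f[1] ∧ g₁[i]) ∨ ((f[2] ∧ g₂[i]) ∨ (⋯ ∨ (f[n] ∧ gₙ[i])))`. -/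
theorem coeff_comp_of_hyperaffine (C : Clone) (hC : C.Hyperaffine)
    (n m : ℕ) (f : C.T (n + 1)) (g : Fin (n + 1) → C.T m) (i : Fin m) :
    C.coeff (C.comp f g) i =
      rfold C.bor (C.band (C.coeff f 0) (C.coeff (g 0) i))
        (List.ofFn fun k : Fin n => C.band (C.coeff f k.succ) (C.coeff (g k.succ) i)) := by
  rw [Clone.coeff_comp]
  have h := hC.rfold_bor_band_coeff f (fun k => C.coeff (g k) i) 0 (List.ofFn Fin.succ)
  rw [List.map_ofFn] at h
  refine Eq.trans ?_ h.symm
  congr 1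
  funext j
  refine (if_pos ?_).symm
  cases j using Fin.cases <;> simp [List.mem_ofFn]
end

section
/- Let T be an affine algebraic theory with Mal'cev operation p ∈ T(3). Then T(2) carries a commutative ring structure whose operations are: a + b := p ∘ (a, π²₂, b), a · b := a ∘ (b, π²₂), −a := p ∘ (π²₂, a, π²₂), 0 := π²₂, 1 := π²₁ (i.e. there exists a CommRing structure on T(2) whose addition, multiplication, negation, zero and one are exactly these operations). -/
/-!
An algebraic theory (abstract clone): a family of sets `T n`,
projections `π n i` and composition `comp`, subject to the unit
and associativity laws.
-/
universe u

namespace Clone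

theorem Commutes.comp_two_comp_two {C : Clone} {f g : C.T 2} (h : C.Commutes f g) {k : ℕ}
    (a b c d : C.T k) :
    C.comp f ![C.comp g ![a, b], C.comp g ![c, d]] =
      C.comp g ![C.comp f ![a, c], C.comp f ![b, d]] := by
  have := h k ![![a, b], ![c, d]]
  convert this using 2 <;> funext i <;> fin_cases i <;> simp <;> congr 1 <;> funext j <;>
    fin_cases j <;> rfl

theorem Commutes.comp_two_comp_three {C : Clone} {f : C.T 2} {g : C.T 3} (h : C.Commutes f g)
    {k : ℕ} (a b c a' b' c' : C.T k) :
    C.comp f ![C.comp g ![a, b, c], C.comp g ![a', b', c']] =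
      C.comp g ![C.comp f ![a, a'], C.comp f ![b, b'], C.comp f ![c, c']] := by
  have := h k ![![a, b, c], ![a', b', c']]
  convert this using 2 <;> funext i <;> fin_cases i <;> simp <;> congr 1 <;> funext j <;>
    fin_cases j <;> rfl

theorem Commutes.comp_three_comp_three {C : Clone} {f g : C.T 3} (h : C.Commutes f g) {k : ℕ}
    (a b c a' b' c' a'' b'' c'' : C.T k) :
    C.comp f ![C.comp g ![a, b, c], C.comp g ![a', b', c'], C.comp g ![a'', b'', c'']] =
      C.comp g ![C.comp f ![a, a', a''], C.comp f ![b, b', b''], C.comp f ![c, c', c'']] := by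
  have := h k ![![a, b, c], ![a', b', c'], ![a'', b'', c'']]
  convert this using 2 <;> funext i <;> fin_cases i <;> simp <;> congr 1 <;> funext j <;>
    fin_cases j <;> rfl

theorem comp_comp_two {C : Clone} {m k : ℕ} (f : C.T 2) (a b : C.T m) (h : Fin m → C.T k) :
    C.comp (C.comp f ![a, b]) h = C.comp f ![C.comp a h, C.comp b h] := by
  rw [C.assoc]; congr 1; funext i; fin_cases i <;> rfl

theorem comp_comp_three {C : Clone} {m k : ℕ} (f : C.T 3) (a b c : C.T m) (h : Fin m → C.T k) :
    C.comp (C.comp f ![a, b, c]) h = C.comp f ![C.comp a h, C.comp b h, C.comp c h] := by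
  rw [C.assoc]; congr 1; funext i; fin_cases i <;> rfl

theorem Idem.comp_two {C : Clone} {f : C.T 2} (h : C.Idem f) {m : ℕ} (a : C.T m) :
    C.comp f ![a, a] = a := by
  convert h m a using 2; funext i; fin_cases i <;> rfl

section Malcev

variable {C : Clone} {p : C.T 3}

theorem Malcev.zero_padd (hp : C.Malcev p) (a : C.T 2) : C.padd p (C.π 2 1) a = a :=
  (hp 2 (C.π 2 1) a).2

theorem Malcev.padd_zero (hp : C.Malcev p) (a : C.T 2) : C.padd p a (C.π 2 1) = a :=
  (hp 2 a (C.π 2 1)).1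

theorem Malcev.padd_comm (hp : C.Malcev p) (hc : C.Commutes p p) (a b : C.T 2) :
    C.padd p a b = C.padd p b a := by
  have h := hc.comp_three_comp_three (C.π 2 1) (C.π 2 1) a (C.π 2 1) (C.π 2 1) (C.π 2 1)
    b (C.π 2 1) (C.π 2 1)
  simpa only [padd, (hp 2 _ _).1, (hp 2 _ _).2] using h

theorem Malcev.padd_assoc (hp : C.Malcev p) (hc : C.Commutes p p) (a b c : C.T 2) :
    C.padd p (C.padd p a b) c = C.padd p a (C.padd p b c) := by
  have h := hc.comp_three_comp_three a (C.π 2 1) b (C.π 2 1) (C.π 2 1) (C.π 2 1)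
    (C.π 2 1) (C.π 2 1) c
  simpa only [padd, (hp 2 _ _).1, (hp 2 _ _).2] using h

theorem Malcev.pneg_padd (hp : C.Malcev p) (hc : C.Commutes p p) (a : C.T 2) :
    C.padd p (C.pneg p a) a = C.π 2 1 := by
  have h := hc.comp_three_comp_three (C.π 2 1) a (C.π 2 1) (C.π 2 1) (C.π 2 1) (C.π 2 1)
    (C.π 2 1) (C.π 2 1) a
  simpa only [padd, pneg, (hp 2 _ _).1, (hp 2 _ _).2] using h

end Malcev

section Band

variable {C : Clone}

theorem band_assoc (a b c : C.T 2) : C.band (C.band a b) c = C.band a (C.band b c) := by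
  simp only [band, comp_comp_two, C.comp_proj]; rfl

theorem one_band (a : C.T 2) : C.band (C.π 2 0) a = a := C.comp_proj _ _

theorem zero_band (a : C.T 2) : C.band (C.π 2 1) a = C.π 2 1 := C.comp_proj _ _

theorem band_one (a : C.T 2) : C.band a (C.π 2 0) = a := by
  rw [band, show ![C.π 2 0, C.π 2 1] = C.π 2 by funext i; fin_cases i <;> rfl, C.proj_comp]

theorem Idem.band_zero {a : C.T 2} (h : C.Idem a) : C.band a (C.π 2 1) = C.π 2 1 := h.comp_two _

theorem Commutes.band_comm {a b : C.T 2} (h : C.Commutes a b) (ha : C.Idem a) (hb : C.Idem b) :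
    C.band a b = C.band b a := by
  have h' := h.comp_two_comp_two (C.π 2 0) (C.π 2 1) (C.π 2 1) (C.π 2 1)
  have one (f : C.T 2) : C.comp f ![C.π 2 0, C.π 2 1] = f := band_one f
  simpa only [band, ha.comp_two, hb.comp_two, one] using h'

theorem padd_band (p : C.T 3) (a b c : C.T 2) :
    C.band (C.padd p a b) c = C.padd p (C.band a c) (C.band b c) := by
  simp only [band, padd, comp_comp_three, C.comp_proj]; rfl

theorem Commutes.band_padd {p : C.T 3} {a : C.T 2} (h : C.Commutes a p) (hp : C.Malcev p)
    (ha : C.Idem a) (b c : C.T 2) :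
    C.band a (C.padd p b c) = C.padd p (C.band a b) (C.band a c) := by
  have h' := h.comp_two_comp_three b (C.π 2 1) c (C.π 2 1) (C.π 2 1) (C.π 2 1)
  simpa only [band, padd, ha.comp_two, (hp 2 _ _).1] using h'

end Band

end Clone

/-- If `T` is affine with Mal'cev operation `p`, then `T(2)` carries a commutative ring
structure with `a + b = p ∘ (a, π²₂, b)`, `a · b = a ∘ (b, π²₂)`, `-a = p ∘ (π²₂, a, π²₂)`,
`0 = π²₂` and `1 = π²₁`. -/
theorem commRing_of_affine (C : Clone)
    (hidem : ∀ (n : ℕ) (f : C.T n), C.Idem f)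
    (hcomm : ∀ (n m : ℕ) (f : C.T n) (g : C.T m), C.Commutes f g)
    (p : C.T 3) (hp : C.Malcev p) :
    ∃ R : CommRing (C.T 2),
      (∀ a b : C.T 2, R.add a b = C.padd p a b) ∧
      (∀ a b : C.T 2, R.mul a b = C.band a b) ∧
      (∀ a : C.T 2, R.neg a = C.pneg p a) ∧
      R.zero = C.π 2 1 ∧ R.one = C.π 2 0 := by
  exact ⟨{
      add := C.padd p
      zero := C.π 2 1
      neg := C.pneg p
      mul := C.band
      one := C.π 2 0
      add_assoc := hp.padd_assoc (hcomm 3 3 p p)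
      zero_add := hp.zero_padd
      add_zero := hp.padd_zero
      add_comm := hp.padd_comm (hcomm 3 3 p p)
      neg_add_cancel := hp.pneg_padd (hcomm 3 3 p p)
      mul_assoc := Clone.band_assoc
      one_mul := Clone.one_band
      mul_one := Clone.band_one
      zero_mul := Clone.zero_band
      mul_zero := fun a => (hidem 2 a).band_zero
      left_distrib := fun a => (hcomm 2 3 a p).band_padd hp (hidem 2 a)
      right_distrib := Clone.padd_band p
      mul_comm := fun a b => (hcomm 2 2 a b).band_comm (hidem 2 a) (hidem 2 b)
      nsmul := @nsmulRec _ ⟨C.π 2 1⟩ ⟨C.padd p⟩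
      zsmul := @zsmulRec _ ⟨C.π 2 1⟩ ⟨C.padd p⟩ ⟨C.pneg p⟩
        (@nsmulRec _ ⟨C.π 2 1⟩ ⟨C.padd p⟩) },
    fun _ _ => rfl, fun _ _ => rfl, fun _ => rfl, rfl, rfl⟩
end

section
/- Let T be an affine algebraic theory with Mal'cev operation p, and let r₁,…,rₙ ∈ T(2) satisfy r₁ + r₂ + ⋯ + rₙ = 1 (left-associated sum, with a + b := p ∘ (a, π²₂, b) and 1 := π²₁). Then there exists f ∈ T(n) whose coefficients satisfy f[i] = rᵢ for all 1 ≤ i ≤ n. -/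
/-!
An algebraic theory (abstract clone): a family of sets `T n`,
projections `π n i` and composition `comp`, subject to the unit
and associativity laws.
-/
universe u

namespace Clone

variable (C : Clone)

/-- Addition with respect to an arbitrary base point `o`: `a +ₒ b := p ∘ (a, o, b)`. -/
def addAt (p : C.T 3) {m : ℕ} (o a b : C.T m) : C.T m := C.comp p ![a, o, b]

theorem comp_comp_vec3 (p : C.T 3) {m k : ℕ} (a b c : C.T m) (g : Fin m → C.T k) :
    C.comp (C.comp p ![a, b, c]) g = C.comp p ![C.comp a g, C.comp b g, C.comp c g] := by
  rw [C.assoc]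
  congr 1
  funext i
  fin_cases i <;> rfl

theorem comp_comp_vec2 (r : C.T 2) {m k : ℕ} (a b : C.T m) (g : Fin m → C.T k) :
    C.comp (C.comp r ![a, b]) g = C.comp r ![C.comp a g, C.comp b g] := by
  rw [C.assoc]
  congr 1
  funext i
  fin_cases i <;> rfl

theorem comp_pair_self {r : C.T 2} (h : C.Idem r) {m : ℕ} (a : C.T m) :
    C.comp r ![a, a] = a := by
  convert h m a using 2
  funext i
  fin_cases i <;> rfl

theorem comp_pair_proj (r : C.T 2) : C.comp r ![C.π 2 0, C.π 2 1] = r := by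
  convert C.proj_comp r using 2
  funext i
  fin_cases i <;> rfl

theorem Commutes.vec3_vec2 {p : C.T 3} {r : C.T 2} (h : C.Commutes p r) {m : ℕ}
    (a b c a' b' c' : C.T m) :
    C.comp p ![C.comp r ![a, a'], C.comp r ![b, b'], C.comp r ![c, c']] =
      C.comp r ![C.comp p ![a, b, c], C.comp p ![a', b', c']] := by
  convert h m ![![a, a'], ![b, b'], ![c, c']] using 2 <;> funext i <;> fin_cases i
  all_goals first | rfl | (simp; congr 1; funext j; fin_cases j <;> rfl)

theorem Commutes.vec3_vec3 {p q : C.T 3} (h : C.Commutes p q) {m : ℕ}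
    (a b c a' b' c' a'' b'' c'' : C.T m) :
    C.comp p ![C.comp q ![a, a', a''], C.comp q ![b, b', b''], C.comp q ![c, c', c'']] =
      C.comp q ![C.comp p ![a, b, c], C.comp p ![a', b', c'], C.comp p ![a'', b'', c'']] := by
  convert h m ![![a, a', a''], ![b, b', b''], ![c, c', c'']] using 2 <;> funext i <;> fin_cases i
  all_goals first | rfl | (simp; congr 1; funext j; fin_cases j <;> rfl)

theorem comp_foldl_addAt (p : C.T 3) {m k : ℕ} (o : C.T m) (g : Fin m → C.T k)
    (l : List (C.T m)) (a : C.T m) :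
    C.comp (l.foldl (C.addAt p o) a) g =
      (l.map fun c => C.comp c g).foldl (C.addAt p (C.comp o g)) (C.comp a g) := by
  induction l generalizing a with
  | nil => rfl
  | cons c l ih =>
    simp only [List.foldl_cons, List.map_cons, ih]
    rw [addAt, comp_comp_vec3, addAt]

theorem foldl_addAt_eq_self {p : C.T 3} (hp : C.Malcev p) {m : ℕ} (o : C.T m)
    (l : List (C.T m)) (hl : ∀ c ∈ l, c = o) (a : C.T m) : l.foldl (C.addAt p o) a = a := by
  induction l generalizing a with
  | nil => rfl
  | cons c l ih =>
    obtain rfl := hl c (by simp)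
    rw [List.foldl_cons, addAt, (hp m a c).1]
    exact ih (fun d hd => hl d (by simp [hd])) a

theorem foldl_addAt_single {p : C.T 3} (hp : C.Malcev p) {m n : ℕ} (o : C.T m)
    (b : Fin n → C.T m) (i : Fin n) (hb : ∀ j, j ≠ i → b j = o) :
    (List.ofFn b).foldl (C.addAt p o) o = b i := by
  induction n with
  | zero => exact i.elim0
  | succ n ih =>
    rw [List.ofFn_succ, List.foldl_cons, addAt, (hp m o (b 0)).2]
    cases i using Fin.cases with
    | zero =>
      apply foldl_addAt_eq_self C hp
      intro c hc
      obtain ⟨j, rfl⟩ := List.mem_ofFn.mp hc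
      exact hb _ (Fin.succ_ne_zero j)
    | succ i =>
      rw [hb 0 (Fin.succ_ne_zero i).symm]
      exact ih (fun j => b j.succ) i fun j hj => hb _ (by simpa using hj)

/-- Subtracting `b` from a sum amounts to subtracting it from the initial term. -/
theorem foldl_addAt_sub {p : C.T 3} (hp : C.Malcev p) (hpp : C.Commutes p p) {m : ℕ}
    (o b : C.T m) (l : List (C.T m)) (a : C.T m) :
    C.comp p ![l.foldl (C.addAt p o) a, b, o] =
      l.foldl (C.addAt p o) (C.comp p ![a, b, o]) := by
  induction l generalizing a with
  | nil => rfl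
  | cons c l ih =>
    rw [List.foldl_cons, List.foldl_cons, ih]
    congr 1
    have h := Commutes.vec3_vec3 C hpp a b o o o o c o o
    rwa [(hp m b o).1, (hp m o o).1, (hp m c o).1] at h

/-- `r(x, y) = y - r(y, x) + x`. -/
theorem malcev_swap {p : C.T 3} (hp : C.Malcev p) {r : C.T 2} (hr : C.Idem r)
    (hpr : C.Commutes p r) {m : ℕ} (x y : C.T m) :
    C.comp p ![y, C.comp r ![y, x], x] = C.comp r ![x, y] := by
  have h := Commutes.vec3_vec2 C hpr y y x y x x
  rwa [comp_pair_self C hr, comp_pair_self C hr, (hp m y x).2, (hp m y x).1] at h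

end Clone

/-- In an affine theory with Mal'cev operation `p`, any tuple `r₁,…,rₙ ∈ T(2)` with
left-associated sum `r₁ + r₂ + ⋯ + rₙ = 1` arises as the coefficients of some `f ∈ T(n)`. -/
theorem exists_op_with_coeffs_of_affine (C : Clone)
    (hidem : ∀ (n : ℕ) (f : C.T n), C.Idem f)
    (hcomm : ∀ (n m : ℕ) (f : C.T n) (g : C.T m), C.Commutes f g)
    (p : C.T 3) (hp : C.Malcev p)
    (n : ℕ) (r : Fin (n + 1) → C.T 2)
    (hsum : lfold (C.padd p) (r 0) (List.ofFn fun i : Fin n => r i.succ) = C.π 2 0) :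
    ∃ f : C.T (n + 1), ∀ i : Fin (n + 1), C.coeff f i = r i := by
  let o := C.π (n + 1) 0
  refine ⟨(List.ofFn fun j : Fin n => C.comp (r j.succ) ![C.π (n + 1) j.succ, o]).foldl
    (C.addAt p o) o, fun i => ?_⟩
  rw [Clone.coeff, Clone.comp_foldl_addAt, List.map_ofFn]
  simp only [Function.comp_def, Clone.comp_comp_vec2, o, C.comp_proj]
  cases i using Fin.cases with
  | zero =>
    have hsum' := congrArg (fun t => C.comp t ![C.π 2 1, C.π 2 0]) hsum
    have hadd : C.padd p = C.addAt p (C.π 2 1) := rfl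
    simp only [lfold, hadd, Clone.comp_foldl_addAt, List.map_ofFn, Function.comp_def,
      C.comp_proj, Matrix.cons_val_zero, Matrix.cons_val_one] at hsum'
    have h := C.foldl_addAt_sub hp (hcomm 3 3 p p) (C.π 2 0)
      (C.comp (r 0) ![C.π 2 1, C.π 2 0])
      (List.ofFn fun j : Fin n => C.comp (r j.succ) ![C.π 2 1, C.π 2 0])
      (C.comp (r 0) ![C.π 2 1, C.π 2 0])
    rw [hsum', C.malcev_swap hp (hidem _ _) (hcomm _ _ _ _), C.comp_pair_proj,
      (hp _ _ _).2] at h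
    simpa [Fin.succ_ne_zero] using h.symm
  | succ i =>
    rw [if_neg (Fin.succ_ne_zero i).symm, C.foldl_addAt_single hp _ _ i]
    · rw [if_pos rfl, C.comp_pair_proj]
    · intro j hj
      rw [if_neg (by simpa using hj), C.comp_pair_self (hidem _ _)]
end
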